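/- arXiv:1602.04745 — 6 statements merged into one kernel-verified Lean document; each statement's English description precedes it below -/
import Mathlib

section
/- Let a : ℕ → ℝ be a bounded sequence such that the sets {n : a(n) > 0} and {n : a(n) < 0} are both infinite. Define Q on the real Hilbert space ℓ²(ℕ, ℝ) by Q(x) = Σ_{n=0}^∞ a(n)·x(n)² (the series converges absolutely for every x ∈ ℓ²). Then for every c ∈ ℝ the level set {x ∈ ℓ²(ℕ, ℝ) : Q(x) = c} is path-connected in the norm topology. -/
open QuadraticMap in
/-- Two positive vectors with nonnegative polar value are joined by a segment of positive
vectors. -/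
lemma QuadraticMap.joinedIn_pos_of_polar_nonneg {E : Type*} [AddCommGroup E] [Module ℝ E]
    [TopologicalSpace E] [ContinuousAdd E] [ContinuousSMul ℝ E] (q : QuadraticForm ℝ E) {x y : E}
    (hx : 0 < q x) (hy : 0 < q y) (hxy : 0 ≤ polar q x y) :
    JoinedIn {z | 0 < q z} x y := by
  refine JoinedIn.of_segment_subset ?_
  rintro _ ⟨s, t, hs, ht, hst, rfl⟩
  have h : q (s • x + t • y) = s * s * q x + t * t * q y + s * t * polar q x y := by
    rw [QuadraticMap.map_add q, polar_smul_left, polar_smul_right, QuadraticMap.map_smul,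
      QuadraticMap.map_smul]
    simp only [smul_eq_mul]
    ring
  simp only [Set.mem_ofPred_eq, h]
  have h1 : 0 ≤ s * t * polar q x y := by positivity
  rcases hs.eq_or_lt with rfl | hs
  · have : t = 1 := by linarith
    subst this
    simpa using hy
  · have : 0 < s * s * q x := by positivity
    have : 0 ≤ t * t * q y := by positivity
    linarith

open QuadraticMap in
/-- The positive cone of a quadratic form that is positive definite on some plane is
path-connected. -/
lemma QuadraticMap.isPathConnected_pos {E : Type*} [AddCommGroup E] [Module ℝ E]
    [TopologicalSpace E] [ContinuousAdd E] [ContinuousSMul ℝ E] (q : QuadraticForm ℝ E) {u v : E}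
    (hu : 0 < q u) (hv : 0 < q v) (huv : polar q u v = 0) :
    IsPathConnected {z | 0 < q z} := by
  refine ⟨u, hu, fun {x} hx => ?_⟩
  rcases le_total 0 (polar q u x) with h | h
  · exact q.joinedIn_pos_of_polar_nonneg hu hx h
  · have hu' : 0 < q (-u) := by rwa [QuadraticMap.map_neg]
    have h1 : JoinedIn {z | 0 < q z} u v := q.joinedIn_pos_of_polar_nonneg hu hv huv.ge
    have h2 : JoinedIn {z | 0 < q z} (-u) v :=
      q.joinedIn_pos_of_polar_nonneg hu' hv (by rw [polar_neg_left, huv, neg_zero])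
    have h3 : JoinedIn {z | 0 < q z} (-u) x :=
      q.joinedIn_pos_of_polar_nonneg hu' hx (by rw [polar_neg_left]; linarith)
    exact (h1.trans h2.symm).trans h3

open QuadraticMap in
lemma QuadraticMap.isPathConnected_eq_of_pos {E : Type*} [AddCommGroup E] [Module ℝ E]
    [TopologicalSpace E] [ContinuousAdd E] [ContinuousSMul ℝ E] (q : QuadraticForm ℝ E)
    (hq : Continuous q) {u v : E} (hu : 0 < q u) (hv : 0 < q v) (huv : polar q u v = 0)
    {c : ℝ} (hc : 0 < c) :
    IsPathConnected {z | q z = c} := by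
  have himage : (fun z => √(c / q z) • z) '' {z | 0 < q z} = {z | q z = c} := by
    ext z
    constructor
    · rintro ⟨w, hw, rfl⟩
      have hw : 0 < q w := hw
      simp only [Set.mem_ofPred_eq, QuadraticMap.map_smul, smul_eq_mul]
      rw [Real.mul_self_sqrt (by positivity)]
      field_simp
    · rintro rfl
      exact ⟨z, hc, by simp [div_self hc.ne']⟩
  rw [← himage]
  refine (q.isPathConnected_pos hu hv huv).image' ?_
  refine ContinuousOn.smul (ContinuousOn.sqrt ?_) continuousOn_id
  exact continuousOn_const.div hq.continuousOn fun z hz => ne_of_gt hz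

lemma QuadraticMap.isPathConnected_eq_zero {E : Type*} [AddCommGroup E] [Module ℝ E]
    [TopologicalSpace E] [ContinuousAdd E] [ContinuousSMul ℝ E] (q : QuadraticForm ℝ E) :
    IsPathConnected {z | q z = 0} := by
  refine ⟨0, q.map_zero, fun {x} hx => JoinedIn.of_segment_subset ?_⟩
  rintro _ ⟨s, t, -, -, -, rfl⟩
  have hx : q x = 0 := hx
  simp [QuadraticMap.map_smul, hx]

open QuadraticMap in
/-- Level sets of a continuous quadratic form that is positive definite on some plane and
negative definite on some plane are path-connected. -/
lemma QuadraticMap.isPathConnected_eq {E : Type*} [AddCommGroup E] [Module ℝ E]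
    [TopologicalSpace E] [ContinuousAdd E] [ContinuousSMul ℝ E] (q : QuadraticForm ℝ E)
    (hq : Continuous q) {u v u' v' : E} (hu : 0 < q u) (hv : 0 < q v) (huv : polar q u v = 0)
    (hu' : q u' < 0) (hv' : q v' < 0) (huv' : polar q u' v' = 0) (c : ℝ) :
    IsPathConnected {z | q z = c} := by
  rcases lt_trichotomy c 0 with hc | rfl | hc
  · have h := (-q).isPathConnected_eq_of_pos (u := u') (v := v') (by simpa using hq.neg)
      (by simpa using hu') (by simpa using hv')
      (by rw [FunLike.coe_neg, polar_neg, huv', neg_zero]) (neg_pos.2 hc)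
    simpa using h
  · exact q.isPathConnected_eq_zero
  · exact q.isPathConnected_eq_of_pos hq hu hv huv hc

lemma lp.summable_mul_mul_of_bounded {a : ℕ → ℝ} {C : ℝ} (ha : ∀ n, |a n| ≤ C)
    (x y : lp (fun _ : ℕ => ℝ) 2) : Summable fun n => |a n * x n * y n| := by
  have h := lp.summable_mul (p := 2) (q := 2) (by simpa using Real.HolderConjugate.two_two) x y
  refine Summable.of_nonneg_of_le (fun n => abs_nonneg _) (fun n => ?_) (h.mul_left C)
  rw [abs_mul, abs_mul, mul_assoc]
  exact mul_le_mul_of_nonneg_right (ha n) (by positivity)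

/-- The diagonal bilinear form on `ℓ²` with bounded coefficients. -/
noncomputable def lp.diagonalBilin (a : ℕ → ℝ) (C : ℝ) (ha : ∀ n, |a n| ≤ C) :
    lp (fun _ : ℕ => ℝ) 2 →L[ℝ] lp (fun _ : ℕ => ℝ) 2 →L[ℝ] ℝ :=
  have hs := fun x y => (lp.summable_mul_mul_of_bounded ha x y).of_abs
  LinearMap.mkContinuous₂
    (LinearMap.mk₂ ℝ (fun x y => ∑' n, a n * x n * y n)
      (fun x x' y => by
        rw [← (hs x y).tsum_add (hs x' y)]
        exact tsum_congr fun n => by simp only [lp.coeFn_add, Pi.add_apply]; ring)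
      (fun r x y => by
        rw [smul_eq_mul, ← tsum_mul_left]
        exact tsum_congr fun n => by
          simp only [lp.coeFn_smul, Pi.smul_apply, smul_eq_mul]; ring)
      (fun x y y' => by
        rw [← (hs x y).tsum_add (hs x y')]
        exact tsum_congr fun n => by simp only [lp.coeFn_add, Pi.add_apply]; ring)
      (fun r x y => by
        rw [smul_eq_mul, ← tsum_mul_left]
        exact tsum_congr fun n => by
          simp only [lp.coeFn_smul, Pi.smul_apply, smul_eq_mul]; ring))
    C fun x y => by
      have hp : (2 : ENNReal).toReal.HolderConjugate (2 : ENNReal).toReal := by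
        simpa using Real.HolderConjugate.two_two
      have h := lp.summable_mul hp x y
      calc ‖∑' n, a n * x n * y n‖ ≤ ∑' n, |a n * x n * y n| :=
            norm_tsum_le_tsum_norm (lp.summable_mul_mul_of_bounded ha x y)
        _ ≤ ∑' n, C * (‖x n‖ * ‖y n‖) := by
            refine (lp.summable_mul_mul_of_bounded ha x y).tsum_le_tsum (fun n => ?_)
              (h.mul_left C)
            rw [abs_mul, abs_mul, mul_assoc]
            exact mul_le_mul_of_nonneg_right (ha n) (by positivity)
        _ = C * ∑' n, ‖x n‖ * ‖y n‖ := tsum_mul_left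
        _ ≤ C * (‖x‖ * ‖y‖) :=
            mul_le_mul_of_nonneg_left (lp.tsum_mul_le_mul_norm hp x y).2
              ((abs_nonneg _).trans (ha 0))
        _ = C * ‖x‖ * ‖y‖ := (mul_assoc _ _ _).symm

lemma lp.diagonalBilin_apply (a : ℕ → ℝ) (C : ℝ) (ha : ∀ n, |a n| ≤ C)
    (x y : lp (fun _ : ℕ => ℝ) 2) :
    lp.diagonalBilin a C ha x y = ∑' n, a n * x n * y n :=
  rfl

lemma lp.diagonalBilin_single (a : ℕ → ℝ) (C : ℝ) (ha : ∀ n, |a n| ≤ C) (i j : ℕ) :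
    lp.diagonalBilin a C ha (lp.single 2 i 1) (lp.single 2 j 1) = if i = j then a i else 0 := by
  rw [lp.diagonalBilin_apply, tsum_eq_single i]
  · simp [Pi.single_apply]
  · intro n hn
    simp [hn]

/-- For a bounded sequence `a : ℕ → ℝ` taking positive values infinitely often
and negative values infinitely often, every level set of the diagonal quadratic form
`Q x = ∑' n, a n * (x n)^2` on `ℓ²(ℕ, ℝ)` is path-connected. -/
theorem level_sets_of_diagonal_quadratic_form_pathConnected
    (a : ℕ → ℝ) (hbd : ∃ C : ℝ, ∀ n, |a n| ≤ C)
    (hpos : {n : ℕ | 0 < a n}.Infinite) (hneg : {n : ℕ | a n < 0}.Infinite)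
    (Q : lp (fun _ : ℕ => ℝ) 2 → ℝ)
    (hQ : ∀ x : lp (fun _ : ℕ => ℝ) 2, Q x = ∑' n : ℕ, a n * (x n) ^ 2)
    (c : ℝ) :
    IsPathConnected {x : lp (fun _ : ℕ => ℝ) 2 | Q x = c} := by
  obtain ⟨C, hC⟩ := hbd
  obtain ⟨i, hi, j, hj, hij⟩ := hpos.nontrivial
  obtain ⟨k, hk, l, hl, hkl⟩ := hneg.nontrivial
  let B := lp.diagonalBilin a C hC
  let q : QuadraticForm ℝ (lp (fun _ : ℕ => ℝ) 2) :=
    LinearMap.BilinMap.toQuadraticMap B.toLinearMap₁₂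
  have hq : ∀ x, q x = B x x := fun _ => rfl
  have hqQ : Q = q := by
    ext x
    rw [hQ, hq, lp.diagonalBilin_apply]
    exact tsum_congr fun n => by ring
  have hcont : Continuous q := B.continuous.clm_apply continuous_id
  have hsingle : ∀ n, q (lp.single 2 n 1) = a n := fun n => by
    rw [hq, lp.diagonalBilin_single, if_pos rfl]
  have hpolar : ∀ m n, m ≠ n →
      QuadraticMap.polar q (lp.single 2 m 1) (lp.single 2 n 1) = 0 := fun m n h => by
    have : QuadraticMap.polar q (lp.single 2 m 1) (lp.single 2 n 1) =
        B (lp.single 2 m 1) (lp.single 2 n 1) + B (lp.single 2 n 1) (lp.single 2 m 1) :=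
      LinearMap.BilinMap.polar_toQuadraticMap _ _
    rw [this, lp.diagonalBilin_single, lp.diagonalBilin_single, if_neg h, if_neg h.symm, add_zero]
  rw [hqQ]
  exact q.isPathConnected_eq hcont ((hsingle i).symm ▸ hi) ((hsingle j).symm ▸ hj) (hpolar i j hij)
    ((hsingle k).symm ▸ hk) ((hsingle l).symm ▸ hl) (hpolar k l hkl) c
end

section
/- Let w : ℝ³ → ℝ³ be a continuously differentiable vector field with div w(x) = 0 for all x ∈ ℝ³, and let f : ℝ³ → ℝ be a continuous function such that ∫_{ℝ³} f(x)·(w(x) · ∇φ(x)) dx = 0 for every smooth compactly supported φ : ℝ³ → ℝ (i.e. the vector field f·w has vanishing divergence in the sense of distributions). Then f is a first integral of w: for every differentiable curve γ : ℝ → ℝ³ satisfying γ'(t) = w(γ(t)) for all t, the function t ↦ f(γ(t)) is constant. -/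
open MeasureTheory

/-- Partial derivative of a scalar function on ℝ³ in the `i`-th coordinate direction. -/
noncomputable def pderiv3 (i : Fin 3) (g : (Fin 3 → ℝ) → ℝ) (x : Fin 3 → ℝ) : ℝ :=
  fderiv ℝ g x (Pi.single i 1)

/-- Divergence of a vector field on ℝ³. -/
noncomputable def div3 (v : (Fin 3 → ℝ) → (Fin 3 → ℝ)) (x : Fin 3 → ℝ) : ℝ :=
  ∑ i, pderiv3 i (fun y => v y i) x

theorem sum_mul_pderiv3 (g : (Fin 3 → ℝ) → ℝ) (x u : Fin 3 → ℝ) :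
    ∑ i, u i * pderiv3 i g x = fderiv ℝ g x u := by
  conv_rhs => rw [pi_eq_sum_univ' u, map_sum]
  refine Finset.sum_congr rfl fun i _ => ?_
  rw [map_smul, smul_eq_mul, pderiv3]

theorem integral_fderiv_apply_eq_zero_of_div3_eq_zero
    {v : (Fin 3 → ℝ) → (Fin 3 → ℝ)} (hv : ContDiff ℝ 1 v) (hdiv : ∀ x, div3 v x = 0)
    {φ : (Fin 3 → ℝ) → ℝ} (hφ : ContDiff ℝ 1 φ) (hc : HasCompactSupport φ) :
    ∫ x, fderiv ℝ φ x (v x) = 0 := by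
  have hvi (i : Fin 3) : ContDiff ℝ 1 fun x => v x i := contDiff_pi.1 hv i
  have hdv (i : Fin 3) : Continuous (pderiv3 i fun x => v x i) :=
    ((hvi i).continuous_fderiv one_ne_zero).clm_apply continuous_const
  have hdφ (i : Fin 3) : Continuous (pderiv3 i φ) :=
    (hφ.continuous_fderiv one_ne_zero).clm_apply continuous_const
  have hcφ (i : Fin 3) : HasCompactSupport (pderiv3 i φ) :=
    hc.fderiv_apply (𝕜 := ℝ) (Pi.single i 1)
  have hint (i : Fin 3) : Integrable fun x => v x i * pderiv3 i φ x :=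
    ((hvi i).continuous.mul (hdφ i)).integrable_of_hasCompactSupport (hcφ i).mul_left
  have hint' (i : Fin 3) : Integrable fun x => pderiv3 i (fun y => v y i) x * φ x :=
    ((hdv i).mul hφ.continuous).integrable_of_hasCompactSupport hc.mul_left
  have hparts (i : Fin 3) : ∫ x, v x i * pderiv3 i φ x
      = -∫ x, pderiv3 i (fun y => v y i) x * φ x :=
    integral_mul_fderiv_eq_neg_fderiv_mul_of_integrable (hint' i) (hint i)
      (((hvi i).continuous.mul hφ.continuous).integrable_of_hasCompactSupport hc.mul_left)
      (fun x _ => (hvi i).differentiable one_ne_zero x)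
      (fun x _ => hφ.differentiable one_ne_zero x)
  simp_rw [← sum_mul_pderiv3]
  rw [integral_finsetSum _ fun i _ => hint i, Finset.sum_congr rfl fun i _ => hparts i,
    Finset.sum_neg_distrib, ← integral_finsetSum _ fun i _ => hint' i]
  simp_rw [← Finset.sum_mul]
  simp only [div3] at hdiv
  simp [hdiv]

theorem div3_const_sub {w : (Fin 3 → ℝ) → (Fin 3 → ℝ)} (c x : Fin 3 → ℝ) :
    div3 (fun y => c - w y) x = -div3 w x := by
  simp [div3, pderiv3, fderiv_const_sub]

theorem fderiv_comp_const_sub (g : (Fin 3 → ℝ) → ℝ) (x y : Fin 3 → ℝ) :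
    fderiv ℝ (fun z => g (x - z)) y = -fderiv ℝ g (x - y) := by
  have hcomp : (fun z => g (x - z))
      = (fun z => g (x + z)) ∘ ContinuousLinearEquiv.neg ℝ (M := Fin 3 → ℝ) := by
    ext z
    simp [sub_eq_add_neg]
  rw [hcomp, ContinuousLinearEquiv.comp_right_fderiv, fderiv_comp_add_left]
  ext u
  simp [sub_eq_add_neg]

/-- The commutator form of the mollified transport term. -/
theorem integral_mul_fderiv_sub_eq_commutator
    {w : (Fin 3 → ℝ) → (Fin 3 → ℝ)} (hw : ContDiff ℝ 1 w) (hdivw : ∀ x, div3 w x = 0)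
    {f : (Fin 3 → ℝ) → ℝ} (hf : Continuous f)
    (hdist : ∀ φ : (Fin 3 → ℝ) → ℝ, ContDiff ℝ (⊤ : ℕ∞) φ → HasCompactSupport φ →
      ∫ x, f x * (∑ i, w x i * pderiv3 i φ x) = 0)
    {g : (Fin 3 → ℝ) → ℝ} (hg : ContDiff ℝ (⊤ : ℕ∞) g) (hgc : HasCompactSupport g)
    (x : Fin 3 → ℝ) :
    ∫ y, f y * fderiv ℝ g (x - y) (w x)
      = ∫ y, (f y - f x) * fderiv ℝ g (x - y) (w x - w y) := by
  have hφ : ContDiff ℝ (⊤ : ℕ∞) fun z => g (x - z) := hg.comp (contDiff_const.sub contDiff_id)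
  have hφc : HasCompactSupport fun z => g (x - z) :=
    hgc.comp_homeomorph (Homeomorph.subLeft x)
  have hg' : Continuous fun y => fderiv ℝ g (x - y) :=
    (hg.continuous_fderiv (by simp)).comp (continuous_const.sub continuous_id)
  have hgc' : HasCompactSupport fun y => fderiv ℝ g (x - y) :=
    (hgc.fderiv (𝕜 := ℝ)).comp_homeomorph (Homeomorph.subLeft x)
  have hint {a : (Fin 3 → ℝ) → ℝ} {u : (Fin 3 → ℝ) → (Fin 3 → ℝ)} (ha : Continuous a)
      (hu : Continuous u) : Integrable fun y => a y * fderiv ℝ g (x - y) (u y) := by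
    refine (ha.mul (hg'.clm_apply hu)).integrable_of_hasCompactSupport (hgc'.mono ?_)
    intro y hy h
    exact hy (by simp [h])
  have h1 : ∫ y, f y * fderiv ℝ g (x - y) (w y) = 0 := by
    have := hdist _ hφ hφc
    simp_rw [sum_mul_pderiv3, fderiv_comp_const_sub] at this
    simpa [integral_neg] using this
  have h2 : ∫ y, f x * fderiv ℝ g (x - y) (w x - w y) = 0 := by
    have := integral_fderiv_apply_eq_zero_of_div3_eq_zero (contDiff_const.sub hw : ContDiff ℝ 1
      fun y => w x - w y) (fun y => by rw [div3_const_sub, hdivw, neg_zero])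
      (hφ.of_le (by simp)) hφc
    simp_rw [fderiv_comp_const_sub, neg_apply, integral_neg,
      neg_eq_zero] at this
    rw [integral_const_mul, this, mul_zero]
  have hwc := hw.continuous
  have hsplit : ∀ y, (f y - f x) * fderiv ℝ g (x - y) (w x - w y) =
      f y * fderiv ℝ g (x - y) (w x) - f y * fderiv ℝ g (x - y) (w y)
        - f x * fderiv ℝ g (x - y) (w x - w y) := fun y => by
    rw [map_sub]
    ring
  have hi : Integrable fun y => f y * fderiv ℝ g (x - y) (w x) := hint hf continuous_const
  have hi' : Integrable fun y => f x * fderiv ℝ g (x - y) (w x - w y) :=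
    hint continuous_const (continuous_const.sub hwc)
  have hisub : Integrable fun y =>
      f y * fderiv ℝ g (x - y) (w x) - f y * fderiv ℝ g (x - y) (w y) := hi.sub (hint hf hwc)
  simp_rw [hsplit]
  rw [integral_sub hisub hi', integral_sub hi (hint hf hwc), h1, h2, sub_zero, sub_zero]

theorem abs_integral_le_of_closedBall {h : (Fin 3 → ℝ) → ℝ} {x : Fin 3 → ℝ} {ε C : ℝ}
    (hε : 0 ≤ ε) (hsupp : ∀ y, y ∉ Metric.closedBall x ε → h y = 0)
    (hC : ∀ y ∈ Metric.closedBall x ε, |h y| ≤ C) :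
    |∫ y, h y| ≤ C * (2 * ε) ^ 3 := by
  have hvol := Real.volume_pi_closedBall x hε
  rw [← setIntegral_eq_integral_of_forall_compl_eq_zero hsupp]
  refine (norm_setIntegral_le_of_norm_le_const (f := h) measure_closedBall_lt_top hC).trans_eq ?_
  rw [Measure.real, hvol, ENNReal.toReal_ofReal (by positivity), Fintype.card_fin]

/-- If `w` is a `C¹` divergence-free field on ℝ³ and `f` is continuous with
`f • w` divergence-free in the sense of distributions, then `f` is a first integral of `w`:
it is constant along every integral curve of `w`. -/
theorem first_integral_of_distributionally_divFree
    (w : (Fin 3 → ℝ) → (Fin 3 → ℝ)) (hw : ContDiff ℝ 1 w)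
    (hdivw : ∀ x, div3 w x = 0)
    (f : (Fin 3 → ℝ) → ℝ) (hf : Continuous f)
    (hdist : ∀ φ : (Fin 3 → ℝ) → ℝ, ContDiff ℝ (⊤ : ℕ∞) φ → HasCompactSupport φ →
      ∫ x, f x * (∑ i, w x i * pderiv3 i φ x) = 0)
    (γ : ℝ → (Fin 3 → ℝ)) (hγ : ∀ t : ℝ, HasDerivAt γ (w (γ t)) t) :
    ∀ s t : ℝ, f (γ s) = f (γ t) := by
  intro s t
  -- a compact ball containing a unit neighbourhood of the arc
  obtain ⟨R, hR⟩ : ∃ R, ∀ τ ∈ Set.uIcc s t, ‖γ τ‖ ≤ R :=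
    isCompact_uIcc.exists_bound_of_continuousOn
      (fun τ _ => (hγ τ).continuousAt.continuousWithinAt)
  set K := Metric.closedBall (0 : Fin 3 → ℝ) (R + 1)
  have hK : IsCompact K := isCompact_closedBall _ _
  obtain ⟨L, hL⟩ := hw.contDiffOn.exists_lipschitzOnWith one_ne_zero
    (convex_closedBall 0 (R + 1)) hK
  have hLw := hL.dist_le_mul
  have hfK := hK.uniformContinuousOn_of_continuous hf.continuousOn
  let ρ : ContDiffBump (0 : Fin 3 → ℝ) := ⟨1 / 2, 1, by norm_num, by norm_num⟩
  obtain ⟨M, hM⟩ := (ρ.contDiff (n := 1)).continuous_fderiv one_ne_zero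
    |>.bounded_above_of_compact_support (ρ.hasCompactSupport.fderiv (𝕜 := ℝ))
  have hM0 : 0 ≤ M := (norm_nonneg _).trans (hM 0)
  set c := ∫ x, ρ x
  have hc : 0 < c := ρ.integral_pos
  have hmain : ∀ ω > 0, |f (γ t) - f (γ s)| * c ≤ ω * (8 * M * L * |t - s| + 16) := by
    intro ω hω
    obtain ⟨δ, hδ, hfδ⟩ := Metric.uniformContinuousOn_iff_le.1 hfK ω hω
    obtain ⟨ε, hε, hε1, hεδ⟩ : ∃ ε > 0, ε ≤ 1 ∧ ε ≤ δ :=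
      ⟨min 1 δ, by positivity, min_le_left _ _, min_le_right _ _⟩
    let g : (Fin 3 → ℝ) → ℝ := fun x => ρ (ε⁻¹ • x)
    have hg : ContDiff ℝ (⊤ : ℕ∞) g := ρ.contDiff.comp (contDiff_const_smul _)
    have hgc : HasCompactSupport g := ρ.hasCompactSupport.comp_smul (inv_ne_zero hε.ne')
    have hg1 : ContDiff ℝ 1 g := hg.of_le (by simp)
    have hscale {x y : Fin 3 → ℝ} (hy : y ∉ Metric.closedBall x ε) :
        ε⁻¹ • (x - y) ∉ tsupport ρ := by
      rw [ρ.tsupport_eq, mem_closedBall_zero_iff, norm_smul, norm_inv, Real.norm_of_nonneg hε.le,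
        inv_mul_le_iff₀ hε, mul_one, ← dist_eq_norm, dist_comm]
      exact hy
    have hg0 {x y : Fin 3 → ℝ} (hy : y ∉ Metric.closedBall x ε) : g (x - y) = 0 :=
      image_eq_zero_of_notMem_tsupport (f := ρ) (hscale hy)
    have hdg_zero {x y : Fin 3 → ℝ} (hy : y ∉ Metric.closedBall x ε) : fderiv ℝ g (x - y) = 0 := by
      rw [fderiv_comp_smul, fderiv_of_notMem_tsupport ℝ (hscale hy), smul_zero]
    have hdg_le (x : Fin 3 → ℝ) : ‖fderiv ℝ g x‖ ≤ ε⁻¹ * M := by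
      rw [fderiv_comp_smul, norm_smul, norm_inv, Real.norm_of_nonneg hε.le]
      gcongr
      exact hM _
    have hgint (x : Fin 3 → ℝ) : ∫ y, g (x - y) = ε ^ 3 * c := by
      rw [integral_sub_left_eq_self g volume x, Measure.integral_comp_inv_smul_of_nonneg _ _ hε.le]
      simp [c]
    have hxK {τ : ℝ} (hτ : τ ∈ Set.uIcc s t) {y : Fin 3 → ℝ}
        (hy : y ∈ Metric.closedBall (γ τ) ε) : y ∈ K := by
      rw [mem_closedBall_zero_iff]
      have := norm_le_norm_add_norm_sub' y (γ τ)
      have hy' : ‖y - γ τ‖ ≤ ε := by rwa [← dist_eq_norm]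
      linarith [hR τ hτ]
    have hosc {τ : ℝ} (hτ : τ ∈ Set.uIcc s t) {y : Fin 3 → ℝ}
        (hy : y ∈ Metric.closedBall (γ τ) ε) : |f y - f (γ τ)| ≤ ω := by
      rw [← Real.dist_eq]
      exact hfδ _ (hxK hτ hy) _ (hxK hτ (Metric.mem_closedBall_self hε.le)) (hy.trans hεδ)
    let F : (Fin 3 → ℝ) → ℝ := fun x => ∫ y, f y * g (x - y)
    let F' : (Fin 3 → ℝ) → ℝ := fun x => ∫ y, f y * fderiv ℝ g (x - y) (w x)
    have hF (τ : ℝ) : HasDerivAt (fun τ => F (γ τ)) (F' (γ τ)) τ := by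
      have h := hgc.hasFDerivAt_convolution_right (ContinuousLinearMap.mul ℝ ℝ)
        (hf.locallyIntegrable (μ := volume)) hg1 (γ τ)
      have h' := h.comp_hasDerivAt τ (hγ τ)
      rwa [convolution_precompR_apply _ hf.locallyIntegrable (hgc.fderiv (𝕜 := ℝ))
        (hg1.continuous_fderiv one_ne_zero)] at h'
    have hF' {τ : ℝ} (hτ : τ ∈ Set.uIcc s t) : ‖F' (γ τ)‖ ≤ 8 * ω * M * L * ε ^ 3 := by
      rw [Real.norm_eq_abs]
      simp only [F', integral_mul_fderiv_sub_eq_commutator hw hdivw hf hdist hg hgc]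
      calc _ ≤ (ω * (ε⁻¹ * M * (L * ε))) * (2 * ε) ^ 3 := by
            refine abs_integral_le_of_closedBall (x := γ τ) hε.le (fun y hy => by simp [hdg_zero hy])
              fun y hy => ?_
            rw [abs_mul]
            refine mul_le_mul (hosc hτ hy) ?_ (abs_nonneg _) hω.le
            refine ((fderiv ℝ g (γ τ - y)).le_opNorm (w (γ τ) - w y)).trans ?_
            refine mul_le_mul (hdg_le _) ?_ (norm_nonneg _) (by positivity)
            rw [← dist_eq_norm, dist_comm]
            refine (hLw _ (hxK hτ hy) _ (hxK hτ (Metric.mem_closedBall_self hε.le))).trans ?_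
            gcongr
            exact hy
        _ = _ := by field_simp; ring
    have hFf {τ : ℝ} (hτ : τ ∈ Set.uIcc s t) :
        |F (γ τ) - f (γ τ) * (ε ^ 3 * c)| ≤ 8 * ω * ε ^ 3 := by
      have hgτ : Continuous fun y => g (γ τ - y) :=
        hg1.continuous.comp (continuous_const.sub continuous_id)
      have hgτc : HasCompactSupport fun y => g (γ τ - y) :=
        hgc.comp_homeomorph (Homeomorph.subLeft (γ τ))
      have hi : Integrable fun y => f y * g (γ τ - y) :=
        (hf.mul hgτ).integrable_of_hasCompactSupport hgτc.mul_left
      have hi' : Integrable fun y => f (γ τ) * g (γ τ - y) :=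
        (continuous_const.mul hgτ).integrable_of_hasCompactSupport hgτc.mul_left
      rw [← hgint (γ τ), ← integral_const_mul, ← integral_sub hi hi']
      calc _ ≤ ω * (2 * ε) ^ 3 := by
            refine abs_integral_le_of_closedBall (x := γ τ) hε.le (fun y hy => by simp [hg0 hy])
              fun y hy => ?_
            rw [← sub_mul, abs_mul, abs_of_nonneg (ρ.nonneg : 0 ≤ g (γ τ - y))]
            exact (mul_le_of_le_one_right (abs_nonneg _) ρ.le_one).trans (hosc hτ hy)
        _ = _ := by ring
    have hinc : |F (γ t) - F (γ s)| ≤ 8 * ω * M * L * ε ^ 3 * |t - s| :=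
      (convex_uIcc s t).norm_image_sub_le_of_norm_hasDerivWithin_le
        (fun τ _ => (hF τ).hasDerivWithinAt) (fun τ hτ => hF' hτ)
        Set.left_mem_uIcc Set.right_mem_uIcc
    have hs := hFf (Set.left_mem_uIcc : s ∈ Set.uIcc s t)
    have ht := hFf (Set.right_mem_uIcc : t ∈ Set.uIcc s t)
    refine le_of_mul_le_mul_left ?_ (pow_pos hε 3)
    calc ε ^ 3 * (|f (γ t) - f (γ s)| * c)
        = |f (γ t) * (ε ^ 3 * c) - f (γ s) * (ε ^ 3 * c)| := by
          rw [← sub_mul, abs_mul, abs_of_pos (by positivity : 0 < ε ^ 3 * c)]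
          ring
      _ ≤ 8 * ω * M * L * ε ^ 3 * |t - s| + 8 * ω * ε ^ 3 + 8 * ω * ε ^ 3 := by
          rw [abs_le] at *
          constructor <;> linarith
      _ = ε ^ 3 * (ω * (8 * M * L * |t - s| + 16)) := by ring
  have hzero : |f (γ t) - f (γ s)| * c ≤ 0 := by
    refine le_of_forall_pos_le_add fun η hη => ?_
    have hA : 0 < 8 * M * L * |t - s| + 16 := by positivity
    have := hmain (η / (8 * M * L * |t - s| + 16)) (by positivity)
    rwa [div_mul_cancel₀ _ hA.ne', ← zero_add η] at this
  have habs : |f (γ t) - f (γ s)| ≤ 0 := nonpos_of_mul_nonpos_left hzero hc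
  exact (sub_eq_zero.1 (abs_nonpos_iff.1 habs)).symm
end

section
/- Let v : ℝ³ → ℝ³ be a continuous vector field such that ∫_{ℝ³} v(x) · u(x) dx = 0 for every smooth compactly supported vector field u : ℝ³ → ℝ³ with div u(x) = 0 for all x. Then there exists a continuously differentiable function F : ℝ³ → ℝ with ∇F(x) = v(x) for all x ∈ ℝ³. -/
open MeasureTheory

open scoped Convolution Topology ContDiff
open Filter ContinuousLinearMap

/-- Mollifying a continuous function by normalised bump functions with shrinking supports
converges locally uniformly. -/
theorem ContDiffBump.tendstoLocallyUniformly_convolution {ι E F : Type*}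
    [NormedAddCommGroup E] [NormedSpace ℝ E] [FiniteDimensional ℝ E] [MeasurableSpace E]
    [BorelSpace E] [NormedAddCommGroup F] [NormedSpace ℝ F] [CompleteSpace F]
    (μ : Measure E) [μ.IsAddHaarMeasure] {l : Filter ι} {φ : ι → ContDiffBump (0 : E)}
    (hφ : Tendsto (fun i => (φ i).rOut) l (𝓝 0)) {g : E → F} (hg : Continuous g) :
    TendstoLocallyUniformly (fun i => (φ i).normed μ ⋆[lsmul ℝ ℝ, μ] g) g l := by
  rw [tendstoLocallyUniformly_iff_forall_tendsto]
  intro x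
  have h₁ : Tendsto (fun p : ι × E => g p.2) (l ×ˢ 𝓝 x) (𝓝 (g x)) :=
    (hg.tendsto x).comp tendsto_snd
  have h₂ : Tendsto (fun p : ι × E => ((φ p.1).normed μ ⋆[lsmul ℝ ℝ, μ] g) p.2)
      (l ×ˢ 𝓝 x) (𝓝 (g x)) :=
    ContDiffBump.convolution_tendsto_right (φ := fun p : ι × E => φ p.1) (g := fun _ => g)
      (hφ.comp tendsto_fst) (Eventually.of_forall fun _ => hg.aestronglyMeasurable)
      ((hg.tendsto x).comp tendsto_snd) tendsto_snd
  exact (h₁.prodMk_nhds h₂).mono_right (nhds_le_uniformity (g x))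

/-- A locally uniform limit of exact 1-forms is exact. -/
theorem exists_hasFDerivAt_of_tendstoLocallyUniformly {ι E F : Type*}
    [NormedAddCommGroup E] [NormedSpace ℝ E] [ProperSpace E]
    [NormedAddCommGroup F] [NormedSpace ℝ F] [CompleteSpace F] {l : Filter ι} [l.NeBot]
    {η' : ι → E → E →L[ℝ] F} {η : E → E →L[ℝ] F}
    (hlim : TendstoLocallyUniformly η' η l)
    (hex : ∀ i, ∃ f : E → F, ∀ x, HasFDerivAt f (η' i x) x) :
    ∃ f : E → F, ∀ x, HasFDerivAt f (η x) x := by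
  choose f hf using hex
  have hf₀ : ∀ i x, HasFDerivAt (fun y => f i y - f i 0) (η' i x) x :=
    fun i x => (hf i x).sub_const _
  have hcauchy : ∀ x, Cauchy (map (fun i => f i x - f i 0) l) := by
    intro x
    have hball : UniformCauchySeqOn η' l (Metric.ball 0 (‖x‖ + 1)) :=
      (((tendstoLocallyUniformly_iff_forall_isCompact.1 hlim) _
        (isCompact_closedBall (0 : E) (‖x‖ + 1))).mono
          Metric.ball_subset_closedBall).uniformCauchySeqOn
    refine cauchy_map_of_uniformCauchySeqOn_fderiv (f := fun i y => f i y - f i 0)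
      Metric.isOpen_ball (convex_ball _ _).isPreconnected hball (fun i y _ => hf₀ i y)
      (Metric.mem_ball_self (by positivity)) (by simp) ?_
    simp only [sub_self]
    exact (tendsto_const_nhds (x := (0 : F))).cauchy_map
  choose g hg using fun x => CompleteSpace.complete (hcauchy x)
  exact ⟨g, fun x => hasFDerivAt_of_tendstoLocallyUniformlyOn isOpen_univ
    (tendstoLocallyUniformlyOn_univ.2 hlim) (fun i y _ => hf₀ i y) (fun y _ => hg y)
    (Set.mem_univ x)⟩

/-- Poincaré lemma on the whole space. -/
theorem exists_hasFDerivAt_of_fderiv_symmetric {E F : Type*}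
    [NormedAddCommGroup E] [NormedSpace ℝ E] [NormedAddCommGroup F] [NormedSpace ℝ F]
    [CompleteSpace F] {η : E → E →L[ℝ] F} {dη : E → E →L[ℝ] E →L[ℝ] F}
    (hη : ∀ x, HasFDerivAt η (dη x) x) (hsymm : ∀ x a b, dη x a b = dη x b a) :
    ∃ f : E → F, ∀ x, HasFDerivAt f (η x) x :=
  ⟨_, fun x => (hasFDerivWithinAt_univ.1 <|
    convex_univ.hasFDerivWithinAt_curveIntegral_segment_of_hasFDerivWithinAt_symmetric
      (fun y _ => (hη y).hasFDerivWithinAt) (fun y _ a _ b _ => hsymm y a b)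
      (Set.mem_univ 0) (Set.mem_univ x))⟩

section WeaklyClosed

variable {E : Type*} [NormedAddCommGroup E] [NormedSpace ℝ E] [FiniteDimensional ℝ E]
  [MeasurableSpace E] [BorelSpace E]

/-- A 1-form is weakly closed if its exterior derivative vanishes in the sense of distributions. -/
def IsWeaklyClosed (μ : Measure E) (η : E → E →L[ℝ] ℝ) : Prop :=
  ∀ ψ : E → ℝ, ContDiff ℝ ∞ ψ → HasCompactSupport ψ → ∀ a b,
    ∫ y, (fderiv ℝ ψ y a * η y b - fderiv ℝ ψ y b * η y a) ∂μ = 0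

variable {μ : Measure E} [μ.IsAddHaarMeasure] {η : E → E →L[ℝ] ℝ} {φ : E → ℝ}

/-- Directional derivatives of the mollification of a 1-form. -/
theorem fderiv_convolution_apply (hη : Continuous η) (hφ : ContDiff ℝ ∞ φ)
    (hφc : HasCompactSupport φ) (x a b : E) :
    Integrable (fun y => fderiv ℝ φ (x - y) a * η y b) μ ∧
    fderiv ℝ (φ ⋆[lsmul ℝ ℝ, μ] η) x a b =
      ∫ y, fderiv ℝ φ (x - y) a * η y b ∂μ := by
  have hint : Integrable (fun t => (lsmul ℝ ℝ).precompL E (fderiv ℝ φ t) (η (x - t))) μ :=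
    (hφc.fderiv ℝ).convolutionExists_left (𝕜 := ℝ) (F := E →L[ℝ] E →L[ℝ] ℝ) _
      (hφ.continuous_fderiv (by simp)) hη.locallyIntegrable x
  have hinta := hint.apply_continuousLinearMap a
  have hintab := (hinta.apply_continuousLinearMap b).comp_sub_left x
  refine ⟨by simpa using hintab, ?_⟩
  rw [(hφc.hasFDerivAt_convolution_left _ (hφ.of_le (by simp)) hη.locallyIntegrable x).fderiv,
    convolution_def, ContinuousLinearMap.integral_apply hint,
    ContinuousLinearMap.integral_apply hinta, ← integral_sub_left_eq_self _ μ x]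
  simp

/-- Mollifying a continuous weakly closed 1-form gives a closed 1-form. -/
theorem IsWeaklyClosed.convolution_symmetric (h : IsWeaklyClosed μ η) (hη : Continuous η)
    (hφ : ContDiff ℝ ∞ φ) (hφc : HasCompactSupport φ) (x a b : E) :
    fderiv ℝ (φ ⋆[lsmul ℝ ℝ, μ] η) x a b =
      fderiv ℝ (φ ⋆[lsmul ℝ ℝ, μ] η) x b a := by
  obtain ⟨hab, eab⟩ := fderiv_convolution_apply (μ := μ) hη hφ hφc x a b
  obtain ⟨hba, eba⟩ := fderiv_convolution_apply (μ := μ) hη hφ hφc x b a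
  have hψ := h (fun y => φ (x - y)) (hφ.comp (contDiff_const.sub contDiff_id))
    (hφc.comp_homeomorph (Homeomorph.subLeft x)) b a
  have hd (y : E) : fderiv ℝ (fun y => φ (x - y)) y = -fderiv ℝ φ (x - y) := by
    have hφd : HasFDerivAt φ (fderiv ℝ φ (x - y)) (x - y) :=
      (hφ.differentiable (by simp) _).hasFDerivAt
    simpa [Function.comp_def] using (hφd.comp y ((hasFDerivAt_id y).const_sub x)).fderiv
  simp only [hd, neg_apply, neg_mul, sub_neg_eq_add, neg_add_eq_sub] at hψ
  rw [eab, eba, ← sub_eq_zero, ← integral_sub hab hba, hψ]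

/-- A continuous weakly closed 1-form on a finite-dimensional space is exact. -/
theorem IsWeaklyClosed.exists_hasFDerivAt (h : IsWeaklyClosed μ η) (hη : Continuous η) :
    ∃ f : E → ℝ, ∀ x, HasFDerivAt f (η x) x := by
  let φ : ℕ → ContDiffBump (0 : E) := fun n =>
    ⟨1 / (n + 1) / 2, 1 / (n + 1), by positivity, half_lt_self (by positivity)⟩
  have hφ : Tendsto (fun n => (φ n).rOut) atTop (𝓝 0) := tendsto_one_div_add_atTop_nhds_zero_nat
  refine exists_hasFDerivAt_of_tendstoLocallyUniformly
    (ContDiffBump.tendstoLocallyUniformly_convolution μ hφ hη) fun n => ?_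
  exact exists_hasFDerivAt_of_fderiv_symmetric
    (fun x => ((φ n).hasCompactSupport_normed.hasFDerivAt_convolution_left _
      (φ n).contDiff_normed hη.locallyIntegrable x).differentiableAt.hasFDerivAt)
    (h.convolution_symmetric hη (φ n).contDiff_normed (φ n).hasCompactSupport_normed)

end WeaklyClosed

/-- The divergence of `g • a - h • b` for constant vectors `a` and `b`. -/
theorem div3_smul_const_sub {g h : (Fin 3 → ℝ) → ℝ} {x : Fin 3 → ℝ}
    (hg : DifferentiableAt ℝ g x) (a b : Fin 3 → ℝ) (hh : DifferentiableAt ℝ h x) :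
    div3 (fun y => g y • a - h y • b) x = fderiv ℝ g x a - fderiv ℝ h x b := by
  have key (L : (Fin 3 → ℝ) →L[ℝ] ℝ) (c : Fin 3 → ℝ) :
      L c = ∑ i, L (Pi.single i 1) * c i := by
    conv_lhs => rw [pi_eq_sum_univ' c]
    simp [map_sum, mul_comm]
  rw [key _ a, key _ b, ← Finset.sum_sub_distrib]
  refine Finset.sum_congr rfl fun i _ => ?_
  have hd : HasFDerivAt (fun y => (g y • a - h y • b) i)
      ((fderiv ℝ g x).smulRight (a i) - (fderiv ℝ h x).smulRight (b i)) x := by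
    exact (hg.hasFDerivAt.smul_const (a i)).sub (hh.hasFDerivAt.smul_const (b i))
  rw [pderiv3, hd.fderiv]
  simp

/-- The 1-form dual to a vector field on ℝ³. -/
noncomputable def dualForm (v : (Fin 3 → ℝ) → (Fin 3 → ℝ)) (x : Fin 3 → ℝ) :
    (Fin 3 → ℝ) →L[ℝ] ℝ :=
  ∑ i, v x i • ContinuousLinearMap.proj i

theorem dualForm_apply (v : (Fin 3 → ℝ) → (Fin 3 → ℝ)) (x a : Fin 3 → ℝ) :
    dualForm v x a = ∑ i, v x i * a i := by
  simp [dualForm]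

theorem continuous_dualForm {v : (Fin 3 → ℝ) → (Fin 3 → ℝ)} (hv : Continuous v) :
    Continuous (dualForm v) := by
  unfold dualForm
  fun_prop

/-- The dual form of a field orthogonal to all divergence-free test fields is weakly closed. -/
theorem isWeaklyClosed_dualForm {v : (Fin 3 → ℝ) → (Fin 3 → ℝ)}
    (horth : ∀ u : (Fin 3 → ℝ) → (Fin 3 → ℝ), ContDiff ℝ ∞ u → HasCompactSupport u →
      (∀ x, div3 u x = 0) → ∫ x, ∑ i, v x i * u x i = 0) :
    IsWeaklyClosed volume (dualForm v) := by
  intro ψ hψ hψc a b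
  have hd (c : Fin 3 → ℝ) : ContDiff ℝ ∞ (fun y => fderiv ℝ ψ y c) :=
    (hψ.fderiv_right (m := ∞) (by simp)).clm_apply contDiff_const
  have hdiff (c x : Fin 3 → ℝ) : DifferentiableAt ℝ (fun y => fderiv ℝ ψ y c) x :=
    (hd c).differentiable (by simp) x
  have hsupp (c d : Fin 3 → ℝ) : HasCompactSupport (fun y => fderiv ℝ ψ y c • d) :=
    (hψc.fderiv_apply ℝ c).smul_right
  have hu := horth (fun y => fderiv ℝ ψ y a • b - fderiv ℝ ψ y b • a)
    (((hd a).smul contDiff_const).sub ((hd b).smul contDiff_const))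
    ((hsupp a b).sub (hsupp b a)) fun x => by
      have hψ₂ : DifferentiableAt ℝ (fderiv ℝ ψ) x :=
        (hψ.fderiv_right (m := ∞) (by simp)).differentiable (by simp) x
      rw [div3_smul_const_sub (hdiff a x) _ _ (hdiff b x), fderiv_clm_apply hψ₂ (by fun_prop),
        fderiv_clm_apply hψ₂ (by fun_prop)]
      have hs := (hψ.contDiffAt (x := x)).isSymmSndFDerivAt (by simpa using ENat.LEInfty.out)
      simp [hs.eq a b]
  rw [← hu]
  refine integral_congr_ae (Eventually.of_forall fun y => ?_)
  simp only [← dualForm_apply, map_sub, map_smul, smul_eq_mul]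

/-- A continuous vector field on ℝ³ that is L²-orthogonal to every smooth
compactly supported divergence-free field is the gradient of a `C¹` function. -/
theorem gradient_of_orthogonal_to_divFree
    (v : (Fin 3 → ℝ) → (Fin 3 → ℝ)) (hv : Continuous v)
    (horth : ∀ u : (Fin 3 → ℝ) → (Fin 3 → ℝ), ContDiff ℝ (⊤ : ℕ∞) u → HasCompactSupport u →
      (∀ x, div3 u x = 0) → ∫ x, ∑ i, v x i * u x i = 0) :
    ∃ F : (Fin 3 → ℝ) → ℝ, ContDiff ℝ 1 F ∧ ∀ x, ∀ i, pderiv3 i F x = v x i := by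
  obtain ⟨F, hF⟩ := (isWeaklyClosed_dualForm horth).exists_hasFDerivAt (continuous_dualForm hv)
  refine ⟨F, contDiff_one_iff_hasFDerivAt.2 ⟨_, continuous_dualForm hv, hF⟩, fun x i => ?_⟩
  rw [pderiv3, (hF x).fderiv, dualForm_apply]
  simp [Pi.single_apply]
end

section
/- Let v : ℝ³ → ℝ³ be a continuous ℤ³-periodic vector field such that ∫_{[0,1]³} v(x) · u(x) dx = 0 for every smooth ℤ³-periodic vector field u : ℝ³ → ℝ³ with div u(x) = 0 for all x. Then there exists a continuously differentiable ℤ³-periodic function F : ℝ³ → ℝ with ∇F(x) = v(x) for all x ∈ ℝ³. -/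
open MeasureTheory

/-- A map defined on ℝ³ is ℤ³-periodic if translating by any integer vector leaves it
unchanged. -/
def ZPeriodic {α : Type*} (f : (Fin 3 → ℝ) → α) : Prop :=
  ∀ (x : Fin 3 → ℝ) (k : Fin 3 → ℤ), f (x + fun i => (k i : ℝ)) = f x

open Set

/-- The integral over the unit cube of a periodic function is translation invariant. -/
lemma ZPeriodic.setIntegral_add_right {g : (Fin 3 → ℝ) → ℝ} (hg : ZPeriodic g) (w : Fin 3 → ℝ) :
    ∫ x in Icc (0 : Fin 3 → ℝ) 1, g (x + w) = ∫ x in Icc (0 : Fin 3 → ℝ) 1, g x := by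
  have hD := ZSpan.isAddFundamentalDomain (Pi.basisFun ℝ (Fin 3)) volume
  have hD' := hD.vadd_of_comm w
  have hae : ZSpan.fundamentalDomain (Pi.basisFun ℝ (Fin 3)) =ᵐ[volume]
      Icc (0 : Fin 3 → ℝ) 1 := by
    rw [ZSpan.fundamentalDomain_pi_basisFun]
    exact Measure.univ_pi_Ico_ae_eq_Icc
  have hinv : ∀ (k : Submodule.span ℤ (range (Pi.basisFun ℝ (Fin 3)))) (x : Fin 3 → ℝ),
      g (k +ᵥ x) = g x := by
    intro k x
    obtain ⟨m, hm⟩ : ∃ m : Fin 3 → ℤ, (k : Fin 3 → ℝ) = fun i => (m i : ℝ) := by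
      have := ((Pi.basisFun ℝ (Fin 3)).mem_span_iff_repr_mem ℤ (k : Fin 3 → ℝ)).mp k.2
      choose m hm using this
      exact ⟨m, by ext i; simpa using (hm i).symm⟩
    rw [Submodule.vadd_def, hm, vadd_eq_add, add_comm]
    exact hg x m
  have : VAddInvariantMeasure (Submodule.span ℤ (range (Pi.basisFun ℝ (Fin 3)))) (Fin 3 → ℝ)
      volume := ⟨fun c s _ => measure_preimage_add volume (c : Fin 3 → ℝ) s⟩
  simp only [← setIntegral_congr_set hae]
  rw [hD.setIntegral_eq (f := g) hD' hinv, ← image_vadd,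
    (measurePreserving_vadd w volume).setIntegral_image_emb (measurableEmbedding_const_vadd w)]
  simp [add_comm]

lemma ZPeriodic.mul {f g : (Fin 3 → ℝ) → ℝ} (hf : ZPeriodic f) (hg : ZPeriodic g) :
    ZPeriodic fun x => f x * g x := fun x k => by simp only [hf x k, hg x k]

lemma ZPeriodic.comp_add_right {α : Type*} {f : (Fin 3 → ℝ) → α} (hf : ZPeriodic f)
    (w : Fin 3 → ℝ) : ZPeriodic fun x => f (x + w) := fun x k => by
  simpa only [add_right_comm] using hf (x + w) k

/-- Averaging along a path is symmetric with respect to the pairing of periodic functions, up to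
reversal of the path. -/
lemma ZPeriodic.setIntegral_mul_intervalIntegral_comm {f g : (Fin 3 → ℝ) → ℝ} (hf : Continuous f)
    (hg : Continuous g) (hfp : ZPeriodic f) (hgp : ZPeriodic g) {γ : ℝ → Fin 3 → ℝ}
    (hγ : Continuous γ) :
    ∫ x in Icc (0 : Fin 3 → ℝ) 1, f x * ∫ t in (0 : ℝ)..1, g (x - γ t) =
      ∫ x in Icc (0 : Fin 3 → ℝ) 1, g x * ∫ t in (0 : ℝ)..1, f (x + γ t) := by
  have swap : ∀ F : (Fin 3 → ℝ) → ℝ → ℝ, Continuous (Function.uncurry F) →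
      ∫ x in Icc (0 : Fin 3 → ℝ) 1, ∫ t in Icc (0 : ℝ) 1, F x t =
        ∫ t in Icc (0 : ℝ) 1, ∫ x in Icc (0 : Fin 3 → ℝ) 1, F x t := by
    intro F hF
    refine integral_integral_swap ?_
    rw [Measure.prod_restrict]
    exact hF.continuousOn.integrableOn_compact (isCompact_Icc.prod isCompact_Icc)
  simp only [intervalIntegral.integral_of_le zero_le_one, ← integral_Icc_eq_integral_Ioc,
    ← integral_const_mul]
  rw [swap _ (by fun_prop), swap _ (by fun_prop)]
  refine integral_congr_ae (Filter.Eventually.of_forall fun t => ?_)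
  have h : ZPeriodic fun x => f x * g (x - γ t) := by
    simpa only [sub_eq_add_neg] using hfp.mul (hgp.comp_add_right (-γ t))
  simpa [mul_comm] using (h.setIntegral_add_right (γ t)).symm

/-- A continuous periodic function orthogonal to all smooth periodic functions is nonpositive at
`0`. -/
lemma apply_zero_nonpos_of_orthogonal_smooth {G : (Fin 3 → ℝ) → ℝ} (hG : Continuous G)
    (hGp : ZPeriodic G)
    (h : ∀ φ : (Fin 3 → ℝ) → ℝ, ContDiff ℝ (⊤ : ℕ∞) φ → ZPeriodic φ →
      ∫ x in Icc (0 : Fin 3 → ℝ) 1, φ x * G x = 0) : G 0 ≤ 0 := by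
  by_contra! hpos
  let s : (Fin 3 → ℝ) → ℝ := fun x => ∑ i, Real.sin (Real.pi * x i) ^ 2
  have hs : ContDiff ℝ (⊤ : ℕ∞) s := by fun_prop
  have hsp : ZPeriodic s := by
    intro x k
    refine Finset.sum_congr rfl fun i _ => ?_
    simp only [Pi.add_apply, mul_add]
    rw [mul_comm Real.pi (k i : ℝ), Real.sin_add_int_mul_pi, mul_pow, ← zpow_natCast, ← zpow_mul,
      mul_comm (k i), zpow_mul]
    simp
  have hs0 : ∀ x, s x ≤ 0 → 0 < G x := by
    intro x hx
    have h0 : ∀ i, Real.sin (Real.pi * x i) = 0 := by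
      have := (Finset.sum_eq_zero_iff_of_nonneg (s := Finset.univ)
        (f := fun i => Real.sin (Real.pi * x i) ^ 2) fun i _ => sq_nonneg _).mp
        (le_antisymm hx (Finset.sum_nonneg fun i _ => sq_nonneg _))
      exact fun i => by simpa using this i (Finset.mem_univ i)
    choose k hk using fun i => Real.sin_eq_zero_iff.mp (h0 i)
    have hx : x = 0 + fun i => (k i : ℝ) := by
      ext i
      have := hk i
      rw [mul_comm] at this
      simpa using (mul_left_cancel₀ Real.pi_ne_zero this).symm
    rw [hx, hGp]
    exact hpos
  obtain ⟨δ, hδ, hδG⟩ : ∃ δ > 0, ∀ x ∈ Icc (0 : Fin 3 → ℝ) 1, s x < δ → 0 < G x := by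
    have hK : IsCompact (Icc (0 : Fin 3 → ℝ) 1 ∩ {x | G x ≤ 0}) :=
      isCompact_Icc.inter_right (isClosed_le hG continuous_const)
    rcases (Icc (0 : Fin 3 → ℝ) 1 ∩ {x | G x ≤ 0}).eq_empty_or_nonempty with hE | hE
    · refine ⟨1, one_pos, fun x hx _ => ?_⟩
      by_contra! hx'
      exact (hE ▸ (⟨hx, hx'⟩ : x ∈ Icc (0 : Fin 3 → ℝ) 1 ∩ {x | G x ≤ 0}) : x ∈ (∅ : Set _))
    · obtain ⟨y, hy, hmin⟩ := hK.exists_isMinOn hE hs.continuous.continuousOn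
      refine ⟨s y, ?_, fun x hx hxy => ?_⟩
      · by_contra! h'
        exact absurd (hs0 y h') (not_lt.mpr hy.2)
      · by_contra! hx'
        exact absurd (hmin ⟨hx, hx'⟩) (not_le.mpr hxy)
  let φ : (Fin 3 → ℝ) → ℝ := fun x => Real.smoothTransition (δ - s x)
  have hφ : ContDiff ℝ (⊤ : ℕ∞) φ := Real.smoothTransition.contDiff.comp (contDiff_const.sub hs)
  have hφp : ZPeriodic φ := fun x k => by simp only [φ, hsp x k]
  have hnonneg : ∀ x ∈ Icc (0 : Fin 3 → ℝ) 1, 0 ≤ φ x * G x := by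
    intro x hx
    rcases lt_or_ge (s x) δ with hlt | hge
    · exact mul_nonneg (Real.smoothTransition.nonneg _) (hδG x hx hlt).le
    · simp [φ, Real.smoothTransition.zero_of_nonpos (sub_nonpos.mpr hge)]
  have hcont : Continuous fun x => φ x * G x := hφ.continuous.mul hG
  have hzero : 0 < φ 0 * G 0 :=
    mul_pos (Real.smoothTransition.pos_of_pos (by simpa [s] using hδ)) hpos
  have hae := (setIntegral_eq_zero_iff_of_nonneg_ae
    ((ae_restrict_iff' measurableSet_Icc).mpr (Filter.Eventually.of_forall hnonneg))
    (hcont.continuousOn.integrableOn_compact isCompact_Icc)).mp (h φ hφ hφp)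
  have heq := Measure.eqOn_of_ae_eq hae hcont.continuousOn continuousOn_const
    (s := Icc (0 : Fin 3 → ℝ) 1) ?_ (⟨le_rfl, zero_le_one⟩ : (0 : Fin 3 → ℝ) ∈ Icc 0 1)
  · exact hzero.ne' heq
  · rw [← pi_univ_Icc, interior_pi_set finite_univ, closure_pi_set]
    simp


/-- Differentiation under the integral for the average of a `C¹` function along a path. -/
lemma hasFDerivAt_intervalIntegral_sub {E F : Type*} [NormedAddCommGroup E] [NormedSpace ℝ E]
    [FiniteDimensional ℝ E] [NormedAddCommGroup F] [NormedSpace ℝ F] {φ : E → F} (hφ : ContDiff ℝ 1 φ)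
    {γ : ℝ → E} (hγ : Continuous γ) (x : E) :
    HasFDerivAt (fun x => ∫ t in (0 : ℝ)..1, φ (x - γ t))
      (∫ t in (0 : ℝ)..1, fderiv ℝ φ (x - γ t)) x := by
  have hc : Continuous (fderiv ℝ φ) := hφ.continuous_fderiv one_ne_zero
  have hφc := hφ.continuous
  have : SecondCountableTopologyEither ℝ (E →L[ℝ] F) := secondCountableTopologyEither_of_left _ _
  have := FiniteDimensional.proper ℝ E
  have hK : IsCompact ((fun p : E × ℝ => p.1 - γ p.2) '' (Metric.closedBall x 1 ×ˢ Icc 0 1)) :=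
    ((isCompact_closedBall x 1).prod isCompact_Icc).image (by fun_prop)
  obtain ⟨C, hC⟩ := hK.exists_bound_of_continuousOn hc.continuousOn
  refine intervalIntegral.hasFDerivAt_integral_of_dominated_of_fderiv_le
    (F' := fun x t => fderiv ℝ φ (x - γ t)) (bound := fun _ => C)
    (Metric.ball_mem_nhds x one_pos) ?_ ?_ ?_ ?_ ?_ ?_
  · exact Filter.Eventually.of_forall fun y => (by fun_prop : Continuous _).aestronglyMeasurable
  · exact (by fun_prop : Continuous _).intervalIntegrable _ _
  · exact (by fun_prop : Continuous _).aestronglyMeasurable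
  · refine Filter.Eventually.of_forall fun t ht y hy => hC _ ⟨(y, t), ⟨?_, ?_⟩, rfl⟩
    · exact Metric.ball_subset_closedBall hy
    · rw [uIoc_of_le zero_le_one] at ht
      exact Ioc_subset_Icc_self ht
  · exact intervalIntegrable_const
  · refine Filter.Eventually.of_forall fun t _ y _ => ?_
    exact ((hφ.differentiable one_ne_zero (y - γ t)).hasFDerivAt).comp y
      ((hasFDerivAt_id y).sub_const (γ t))

lemma fderiv_intervalIntegral_sub_apply {E F : Type*} [NormedAddCommGroup E] [NormedSpace ℝ E]
    [FiniteDimensional ℝ E] [NormedAddCommGroup F] [NormedSpace ℝ F] {φ : E → F}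
    (hφ : ContDiff ℝ 1 φ) {γ : ℝ → E} (hγ : Continuous γ) (x w : E) :
    fderiv ℝ (fun x => ∫ t in (0 : ℝ)..1, φ (x - γ t)) x w =
      ∫ t in (0 : ℝ)..1, fderiv ℝ φ (x - γ t) w := by
  have hc : Continuous (fderiv ℝ φ) := hφ.continuous_fderiv one_ne_zero
  rw [(hasFDerivAt_intervalIntegral_sub hφ hγ x).fderiv, ContinuousLinearMap.intervalIntegral_apply]
  exact (by fun_prop : Continuous _).intervalIntegrable _ _

lemma ContDiff.intervalIntegral_sub {E F : Type*} [NormedAddCommGroup E] [NormedSpace ℝ E]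
    [FiniteDimensional ℝ E] [NormedAddCommGroup F] [NormedSpace ℝ F] {φ : E → F}
    (hφ : ContDiff ℝ (⊤ : ℕ∞) φ) {γ : ℝ → E} (hγ : Continuous γ) :
    ContDiff ℝ (⊤ : ℕ∞) (fun x => ∫ t in (0 : ℝ)..1, φ (x - γ t)) := by
  refine contDiff_infty.mpr fun n => ?_
  induction n generalizing φ with
  | zero =>
    have := hφ.continuous
    exact contDiff_zero.mpr
      (intervalIntegral.continuous_parametric_intervalIntegral_of_continuous' (by fun_prop) _ _)
  | succ n ih =>
    have h1 : ContDiff ℝ 1 φ := hφ.of_le (by exact_mod_cast le_top)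
    rw [Nat.cast_add, Nat.cast_one, contDiff_succ_iff_fderiv_apply]
    refine ⟨fun x => (hasFDerivAt_intervalIntegral_sub h1 hγ x).differentiableAt, by simp,
      fun y => ?_⟩
    simp only [fderiv_intervalIntegral_sub_apply h1 hγ]
    exact ih (φ := fun x => fderiv ℝ φ x y)
      ((hφ.fderiv_right (m := (⊤ : ℕ∞)) (by simp)).clm_apply contDiff_const)

/-- The work of the vector field `v` along the straight segment from `a` to `a + h`. -/
noncomputable def segmentWork (v : (Fin 3 → ℝ) → Fin 3 → ℝ) (a h : Fin 3 → ℝ) : ℝ :=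
  ∑ i, h i * ∫ t in (0 : ℝ)..1, v (a + t • h) i

/-- The smoothing by `φ` of the current carried by a weighted family of segments. -/
noncomputable def smoothedCurrent {ι : Type*} [Fintype ι] (c : ι → ℝ) (a h : ι → Fin 3 → ℝ)
    (φ : (Fin 3 → ℝ) → ℝ) (x : Fin 3 → ℝ) (i : Fin 3) : ℝ :=
  ∑ j, c j * (h j i * ∫ t in (0 : ℝ)..1, φ (x - (a j + t • h j)))

section

variable {ι : Type*} [Fintype ι] (c : ι → ℝ) (a h : ι → Fin 3 → ℝ) {φ : (Fin 3 → ℝ) → ℝ}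

lemma ZPeriodic.smoothedCurrent (hφ : ZPeriodic φ) : ZPeriodic (smoothedCurrent c a h φ) := by
  intro x k
  ext i
  simp only [_root_.smoothedCurrent, add_sub_right_comm x, hφ _ k]

lemma ContDiff.smoothedCurrent (hφ : ContDiff ℝ (⊤ : ℕ∞) φ) :
    ContDiff ℝ (⊤ : ℕ∞) (smoothedCurrent c a h φ) := by
  refine contDiff_pi.mpr fun i => ContDiff.sum fun j _ => contDiff_const.mul
    (contDiff_const.mul (hφ.intervalIntegral_sub (by fun_prop)))

lemma div3_smoothedCurrent (hφ : ContDiff ℝ 1 φ) (x : Fin 3 → ℝ) :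
    div3 (smoothedCurrent c a h φ) x = ∑ j, c j * (φ (x - a j) - φ (x - (a j + h j))) := by
  have hγ : ∀ j, Continuous fun t : ℝ => a j + t • h j := fun j => by fun_prop
  have hd := fun j => hasFDerivAt_intervalIntegral_sub hφ (hγ j) x
  have hp : ∀ i, pderiv3 i (fun y => smoothedCurrent c a h φ y i) x =
      ∑ j, c j * (h j i *
        fderiv ℝ (fun x => ∫ t in (0 : ℝ)..1, φ (x - (a j + t • h j))) x (Pi.single i 1)) := by
    intro i
    have := HasFDerivAt.fun_sum (u := Finset.univ)
      fun j _ => ((hd j).const_mul (h j i)).const_mul (c j)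
    simp only [pderiv3, smoothedCurrent, this.fderiv, (hd _).fderiv]
    simp
  simp only [div3, hp]
  rw [Finset.sum_comm]
  refine Finset.sum_congr rfl fun j _ => ?_
  rw [← Finset.mul_sum]
  congr 1
  have hsum : ∀ L : (Fin 3 → ℝ) →L[ℝ] ℝ, ∑ i, h j i * L (Pi.single i 1) = L (h j) := by
    intro L
    conv_rhs => rw [pi_eq_sum_univ' (h j)]
    simp [map_sum]
  rw [hsum, fderiv_intervalIntegral_sub_apply hφ (hγ j)]
  have hderiv : ∀ t : ℝ, HasDerivAt (fun t : ℝ => - φ (x - (a j + t • h j)))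
      (fderiv ℝ φ (x - (a j + t • h j)) (h j)) t := by
    intro t
    have h1 : HasDerivAt (fun t : ℝ => x - (a j + t • h j)) (-h j) t := by
      simpa using (((hasDerivAt_id t).smul_const (h j)).const_add (a j)).const_sub x
    have h2 := ((hφ.differentiable one_ne_zero _).hasFDerivAt.comp_hasDerivAt t h1).neg
    rwa [map_neg, neg_neg] at h2
  have hc : Continuous (fderiv ℝ φ) := hφ.continuous_fderiv one_ne_zero
  rw [intervalIntegral.integral_eq_sub_of_hasDerivAt (fun t _ => hderiv t)
    ((by fun_prop : Continuous _).intervalIntegrable _ _)]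
  simp
  ring

end

/-- A continuous periodic field orthogonal to the smooth periodic divergence-free fields does no
work along a weighted family of segments whose boundary vanishes on the torus. -/
lemma sum_mul_segmentWork_eq_zero {v : (Fin 3 → ℝ) → Fin 3 → ℝ} (hv : Continuous v)
    (hvper : ZPeriodic v)
    (horth : ∀ u : (Fin 3 → ℝ) → (Fin 3 → ℝ), ContDiff ℝ (⊤ : ℕ∞) u → ZPeriodic u →
      (∀ x, div3 u x = 0) →
      ∫ x in Icc (0 : Fin 3 → ℝ) 1, ∑ i, v x i * u x i = 0)
    {ι : Type*} [Fintype ι] (c : ι → ℝ) (a h : ι → Fin 3 → ℝ)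
    (hb : ∀ φ : (Fin 3 → ℝ) → ℝ, ZPeriodic φ →
      ∀ x, ∑ j, c j * (φ (x - a j) - φ (x - (a j + h j))) = 0) :
    ∑ j, c j * segmentWork v (a j) (h j) = 0 := by
  let G : (Fin 3 → ℝ) → ℝ := fun y => ∑ j, c j * segmentWork v (y + a j) (h j)
  have hint : ∀ j i, Continuous fun y => ∫ t in (0 : ℝ)..1, v (y + (a j + t • h j)) i :=
    fun j i => intervalIntegral.continuous_parametric_intervalIntegral_of_continuous'
      (by fun_prop) _ _
  have hGe : ∀ y, G y = ∑ i, ∑ j, c j * (h j i * ∫ t in (0 : ℝ)..1, v (y + (a j + t • h j)) i) := by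
    intro y
    simp only [G, segmentWork, Finset.mul_sum, add_assoc]
    exact Finset.sum_comm
  have hG : Continuous G := by
    simp only [funext hGe]
    fun_prop
  have hGp : ZPeriodic G := by
    intro y k
    have hw : ∀ w, v (y + (fun i => (k i : ℝ)) + w) = v (y + w) := fun w => by
      rw [add_right_comm, hvper]
    simp only [hGe, hw]
  have hGo : ∀ φ : (Fin 3 → ℝ) → ℝ, ContDiff ℝ (⊤ : ℕ∞) φ → ZPeriodic φ →
      ∫ x in Icc (0 : Fin 3 → ℝ) 1, φ x * G x = 0 := by
    intro φ hφ hφp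
    have h1 : ContDiff ℝ 1 φ := hφ.of_le (by exact_mod_cast le_top)
    have hφc := hφ.continuous
    have key := horth (smoothedCurrent c a h φ) (hφ.smoothedCurrent c a h)
      (hφp.smoothedCurrent c a h) fun x => by rw [div3_smoothedCurrent c a h h1, hb φ hφp]
    have hint' : ∀ j, Continuous fun x => ∫ t in (0 : ℝ)..1, φ (x - (a j + t • h j)) :=
      fun j => intervalIntegral.continuous_parametric_intervalIntegral_of_continuous'
        (by fun_prop) _ _
    have hI : ∀ {f : (Fin 3 → ℝ) → ℝ}, Continuous f → IntegrableOn f (Icc 0 1) :=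
      fun hf => hf.continuousOn.integrableOn_compact isCompact_Icc
    rw [← key]
    simp only [hGe, smoothedCurrent, Finset.mul_sum]
    rw [integral_finsetSum _ fun i _ => hI (by fun_prop),
      integral_finsetSum _ fun i _ => hI (by fun_prop)]
    refine Finset.sum_congr rfl fun i _ => ?_
    rw [integral_finsetSum _ fun j _ => hI (by fun_prop),
      integral_finsetSum _ fun j _ => hI (by fun_prop)]
    refine Finset.sum_congr rfl fun j _ => ?_
    have hcomm : ∀ p q r s : ℝ, p * (q * (r * s)) = q * r * (p * s) := fun p q r s => by ring
    simp only [hcomm, integral_const_mul]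
    rw [ZPeriodic.setIntegral_mul_intervalIntegral_comm (f := fun x => v x i)
      (γ := fun t => a j + t • h j) (by fun_prop) hφc (fun x k => by simp only [hvper x k]) hφp (by fun_prop)]
  have hle := apply_zero_nonpos_of_orthogonal_smooth hG hGp hGo
  have hge := apply_zero_nonpos_of_orthogonal_smooth (G := fun x => -G x) hG.neg
    (fun x k => by simp only [hGp x k]) fun φ hφ hφp => by simp [integral_neg, hGo φ hφ hφp]
  have h0 : G 0 = 0 := by linarith
  simpa [G] using h0

/-- A `C¹` potential is recovered from path independence of the work along segments. -/
lemma hasFDerivAt_of_sub_eq_segmentWork {v : (Fin 3 → ℝ) → Fin 3 → ℝ} (hv : Continuous v)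
    {F : (Fin 3 → ℝ) → ℝ} (x : Fin 3 → ℝ) (hF : ∀ h, F (x + h) - F x = segmentWork v x h) :
    HasFDerivAt F (∑ i, v x i • ContinuousLinearMap.proj (R := ℝ) (φ := fun _ : Fin 3 => ℝ) i)
      x := by
  rw [hasFDerivAt_iff_isLittleO_nhds_zero]
  have hint : ∀ i, Continuous fun h => ∫ t in (0 : ℝ)..1, v (x + t • h) i :=
    fun i => intervalIntegral.continuous_parametric_intervalIntegral_of_continuous'
      (by fun_prop) _ _
  have he : ∀ h : Fin 3 → ℝ, F (x + h) - F x -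
      (∑ i, v x i • ContinuousLinearMap.proj (R := ℝ) (φ := fun _ : Fin 3 => ℝ) i) h =
      ∑ i, h i * ((∫ t in (0 : ℝ)..1, v (x + t • h) i) - v x i) := by
    intro h
    simp [hF, segmentWork, mul_sub, Finset.sum_sub_distrib, mul_comm]
  simp only [he]
  refine Asymptotics.IsLittleO.fun_sum fun i _ => ?_
  have h1 : (fun h : Fin 3 → ℝ => h i) =O[nhds 0] fun h : Fin 3 → ℝ => h :=
    Asymptotics.IsBigO.of_bound 1 (Filter.Eventually.of_forall fun h => by
      simpa using norm_le_pi_norm h i)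
  have h2 : (fun h : Fin 3 → ℝ => (∫ t in (0 : ℝ)..1, v (x + t • h) i) - v x i) =o[nhds 0]
      fun _ => (1 : ℝ) := by
    rw [Asymptotics.isLittleO_one_iff]
    exact ((hint i).sub (continuous_const (y := v x i))).tendsto' (0 : Fin 3 → ℝ) 0 (by simp)
  have h3 := h1.norm_right.mul_isLittleO h2
  simp only [mul_one] at h3
  exact h3.of_norm_right

/-- A continuous ℤ³-periodic vector field on ℝ³ that is L²-orthogonal (over the
fundamental domain) to every smooth ℤ³-periodic divergence-free field is the gradient of a
`C¹` ℤ³-periodic function. -/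
theorem gradient_of_orthogonal_to_divFree_periodic
    (v : (Fin 3 → ℝ) → (Fin 3 → ℝ)) (hv : Continuous v) (hvper : ZPeriodic v)
    (horth : ∀ u : (Fin 3 → ℝ) → (Fin 3 → ℝ), ContDiff ℝ (⊤ : ℕ∞) u → ZPeriodic u →
      (∀ x, div3 u x = 0) →
      ∫ x in Set.Icc (0 : Fin 3 → ℝ) 1, ∑ i, v x i * u x i = 0) :
    ∃ F : (Fin 3 → ℝ) → ℝ, ContDiff ℝ 1 F ∧ ZPeriodic F ∧
      ∀ x, ∀ i, pderiv3 i F x = v x i := by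
  have hF : ∀ x h, segmentWork v 0 (x + h) - segmentWork v 0 x = segmentWork v x h := by
    intro x h
    have := sum_mul_segmentWork_eq_zero hv hvper horth ![1, -1, -1] ![0, 0, x] ![x + h, x, h]
      fun φ _ y => by
        simp [Fin.sum_univ_three]
    simp [Fin.sum_univ_three] at this
    linarith
  have hd := fun x => hasFDerivAt_of_sub_eq_segmentWork hv x (hF x)
  refine ⟨segmentWork v 0, ?_, ?_, ?_⟩
  · refine contDiff_one_iff_hasFDerivAt.mpr ⟨_, ?_, hd⟩
    fun_prop
  · intro x k
    have := sum_mul_segmentWork_eq_zero hv hvper horth ![1, -1] ![0, 0]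
      ![x + fun i => (k i : ℝ), x] fun φ hφ y => by
        have := hφ (y - (x + fun i => (k i : ℝ))) k
        rw [sub_add_eq_sub_sub, sub_add_cancel] at this
        simp [Fin.sum_univ_two, this, sub_add_eq_sub_sub]
    simp [Fin.sum_univ_two] at this
    linarith
  · intro x i
    simp [pderiv3, (hd x).fderiv, Pi.single_apply]
end

section
/- Let v₁, v₂ : ℝ³ → ℝ³ be continuously differentiable ℤ³-periodic vector fields with curl v₁(x) = curl v₂(x) for all x ∈ ℝ³. Then ∫_{[0,1]³} v₁(x) · curl v₁(x) dx = ∫_{[0,1]³} v₂(x) · curl v₂(x) dx. -/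
open MeasureTheory

/-- Curl of a vector field on ℝ³. -/
noncomputable def curl3 (v : (Fin 3 → ℝ) → (Fin 3 → ℝ)) (x : Fin 3 → ℝ) : Fin 3 → ℝ :=
  ![pderiv3 1 (fun y => v y 2) x - pderiv3 2 (fun y => v y 1) x,
    pderiv3 2 (fun y => v y 0) x - pderiv3 0 (fun y => v y 2) x,
    pderiv3 0 (fun y => v y 1) x - pderiv3 1 (fun y => v y 0) x]

theorem ContDiff.continuous_pderiv3 {g : (Fin 3 → ℝ) → ℝ} (hg : ContDiff ℝ 1 g) (i : Fin 3) :
    Continuous (pderiv3 i g) :=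
  (hg.continuous_fderiv one_ne_zero).clm_apply continuous_const

theorem pderiv3_mul {f g : (Fin 3 → ℝ) → ℝ} {x : Fin 3 → ℝ} (i : Fin 3)
    (hf : DifferentiableAt ℝ f x) (hg : DifferentiableAt ℝ g x) :
    pderiv3 i (fun y => f y * g y) x = f x * pderiv3 i g x + pderiv3 i f x * g x := by
  simp only [pderiv3]
  rw [fderiv_fun_mul hf hg]
  simp [mul_comm]

theorem pderiv3_sub {f g : (Fin 3 → ℝ) → ℝ} {x : Fin 3 → ℝ} (i : Fin 3)
    (hf : DifferentiableAt ℝ f x) (hg : DifferentiableAt ℝ g x) :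
    pderiv3 i (fun y => f y - g y) x = pderiv3 i f x - pderiv3 i g x := by
  simp only [pderiv3]
  rw [fderiv_fun_sub hf hg]
  simp

theorem ContDiff.continuous_curl3 {v : (Fin 3 → ℝ) → (Fin 3 → ℝ)} (hv : ContDiff ℝ 1 v) :
    Continuous (curl3 v) := by
  have hp (i j : Fin 3) : Continuous (pderiv3 i fun y => v y j) :=
    (contDiff_pi.1 hv j).continuous_pderiv3 i
  refine continuous_pi fun i => ?_
  fin_cases i
  · exact (hp 1 2).sub (hp 2 1)
  · exact (hp 2 0).sub (hp 0 2)
  · exact (hp 0 1).sub (hp 1 0)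

/-- The divergence of a `C¹` periodic vector field has zero integral over the unit cube. -/
theorem ZPeriodic.integral_div_eq_zero {F : (Fin 3 → ℝ) → (Fin 3 → ℝ)}
    (hper : ZPeriodic F) (hF : ContDiff ℝ 1 F) :
    ∫ x in Set.Icc (0 : Fin 3 → ℝ) 1, ∑ i, pderiv3 i (fun y => F y i) x = 0 := by
  have hFi (i : Fin 3) : ContDiff ℝ 1 fun y => F y i := contDiff_pi.1 hF i
  have hcont : Continuous fun x => ∑ i, pderiv3 i (fun y => F y i) x :=
    continuous_finsetSum _ fun i _ => (hFi i).continuous_pderiv3 i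
  have key := integral_divergence_of_hasFDerivAt_off_countable' (0 : Fin 3 → ℝ) 1 zero_le_one
    (fun i y => F y i) (fun i => fderiv ℝ fun y => F y i) ∅ Set.countable_empty
    (fun i => (hFi i).continuous.continuousOn)
    (fun x _ i => ((hFi i).differentiable one_ne_zero x).hasFDerivAt)
    (hcont.continuousOn.integrableOn_compact isCompact_Icc)
  refine key.trans (Finset.sum_eq_zero fun i _ => sub_eq_zero.2 ?_)
  refine integral_congr_ae (ae_of_all _ fun x => ?_)
  have hx : i.insertNth ((1 : Fin 3 → ℝ) i) x =
      i.insertNth ((0 : Fin 3 → ℝ) i) x + fun j => ((Pi.single i 1 : Fin 3 → ℤ) j : ℝ) := by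
    ext j
    refine Fin.succAboveCases i ?_ (fun j => ?_) j <;> simp
  change F (i.insertNth _ x) i = F (i.insertNth _ x) i
  rw [hx, hper]

/-- The identity `div (v × w) = w · curl v - v · curl w`. -/
theorem div_crossProduct {v w : (Fin 3 → ℝ) → (Fin 3 → ℝ)} {x : Fin 3 → ℝ}
    (hv : DifferentiableAt ℝ v x) (hw : DifferentiableAt ℝ w x) :
    ∑ i, pderiv3 i (fun y => crossProduct (v y) (w y) i) x =
      ∑ i, w x i * curl3 v x i - ∑ i, v x i * curl3 w x i := by
  have hv' := differentiableAt_pi.1 hv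
  have hw' := differentiableAt_pi.1 hw
  have hmul (i j k : Fin 3) : pderiv3 i (fun y => v y j * w y k - v y k * w y j) x =
      (v x j * pderiv3 i (fun y => w y k) x + pderiv3 i (fun y => v y j) x * w x k) -
      (v x k * pderiv3 i (fun y => w y j) x + pderiv3 i (fun y => v y k) x * w x j) := by
    rw [pderiv3_sub i ((hv' j).fun_mul (hw' k)) ((hv' k).fun_mul (hw' j)),
      pderiv3_mul i (hv' j) (hw' k), pderiv3_mul i (hv' k) (hw' j)]
  simp only [cross_apply, Fin.sum_univ_three, curl3, Matrix.cons_val, hmul]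
  ring

theorem ContDiff.crossProduct {v w : (Fin 3 → ℝ) → (Fin 3 → ℝ)}
    (hv : ContDiff ℝ 1 v) (hw : ContDiff ℝ 1 w) :
    ContDiff ℝ 1 fun y => crossProduct (v y) (w y) := by
  have hv' := contDiff_pi.1 hv
  have hw' := contDiff_pi.1 hw
  simp only [cross_apply]
  refine contDiff_pi.2 fun i => ?_
  fin_cases i
  · exact ((hv' 1).mul (hw' 2)).sub ((hv' 2).mul (hw' 1))
  · exact ((hv' 2).mul (hw' 0)).sub ((hv' 0).mul (hw' 2))
  · exact ((hv' 0).mul (hw' 1)).sub ((hv' 1).mul (hw' 0))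

/-- The helicity integral `∫ v · curl v` over the fundamental domain does not
depend on the choice of the `C¹` ℤ³-periodic vector potential `v`. -/
theorem helicity_independent_of_vector_potential
    (v₁ v₂ : (Fin 3 → ℝ) → (Fin 3 → ℝ))
    (h₁ : ContDiff ℝ 1 v₁) (h₂ : ContDiff ℝ 1 v₂)
    (h₁per : ZPeriodic v₁) (h₂per : ZPeriodic v₂)
    (hcurl : ∀ x, curl3 v₁ x = curl3 v₂ x) :
    ∫ x in Set.Icc (0 : Fin 3 → ℝ) 1, ∑ i, v₁ x i * curl3 v₁ x i =
      ∫ x in Set.Icc (0 : Fin 3 → ℝ) 1, ∑ i, v₂ x i * curl3 v₂ x i := by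
  have hintegrable {v : (Fin 3 → ℝ) → (Fin 3 → ℝ)} (hv : ContDiff ℝ 1 v) :
      IntegrableOn (fun x => ∑ i, v x i * curl3 v x i) (Set.Icc 0 1) := by
    refine ContinuousOn.integrableOn_compact isCompact_Icc (Continuous.continuousOn ?_)
    have := hv.continuous
    have := hv.continuous_curl3
    fun_prop
  have hper : ZPeriodic fun y => crossProduct (v₂ y) (v₁ y) := fun x k => by
    simp only [h₁per x k, h₂per x k]
  rw [← sub_eq_zero, ← integral_sub (hintegrable h₁) (hintegrable h₂),
    ← hper.integral_div_eq_zero (h₂.crossProduct h₁)]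
  refine integral_congr_ae (ae_of_all _ fun x => ?_)
  have hdiv := div_crossProduct (h₂.differentiable one_ne_zero x) (h₁.differentiable one_ne_zero x)
  simp only [hdiv, hcurl]
end

section
/- Let K : ℝ³ → ℝ³ be a continuously differentiable vector field and let B = [a₁,b₁] × [a₂,b₂] × [a₃,b₃] be a rectangular box with aᵢ ≤ bᵢ. Then the total outward flux of curl K through the boundary of B vanishes; explicitly, Σ_{i=1}^{3} ( ∫_{Fᵢ(bᵢ)} (curl K)ᵢ dσ − ∫_{Fᵢ(aᵢ)} (curl K)ᵢ dσ ) = 0, where Fᵢ(s) denotes the face of B on which the i-th coordinate equals s and dσ is two-dimensional Lebesgue measure on that face. -/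
open MeasureTheory

/-- **Green's theorem** for the partial derivatives of `C¹` functions on a rectangle parallel to the
`i`-th and `j`-th coordinate axes. -/
theorem integral_pderiv3_sub_pderiv3 {f g : (Fin 3 → ℝ) → ℝ} (hf : ContDiff ℝ 1 f)
    (hg : ContDiff ℝ 1 g) (i j : Fin 3) (c : Fin 3 → ℝ) (φ : ℝ × ℝ → Fin 3 → ℝ)
    (hφ : ∀ p, φ p = c + p.1 • Pi.single i 1 + p.2 • Pi.single j 1)
    {a₁ b₁ a₂ b₂ : ℝ} (h₁ : a₁ ≤ b₁) (h₂ : a₂ ≤ b₂) :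
    ∫ p in Set.Icc a₁ b₁ ×ˢ Set.Icc a₂ b₂, (pderiv3 i f (φ p) - pderiv3 j g (φ p)) =
      (∫ y in a₂..b₂, f (φ (b₁, y))) - (∫ y in a₂..b₂, f (φ (a₁, y))) -
        ((∫ x in a₁..b₁, g (φ (x, b₂))) - ∫ x in a₁..b₁, g (φ (x, a₂))) := by
  let L : ℝ × ℝ →L[ℝ] (Fin 3 → ℝ) :=
    (ContinuousLinearMap.fst ℝ ℝ ℝ).smulRight (Pi.single i 1) +
      (ContinuousLinearMap.snd ℝ ℝ ℝ).smulRight (Pi.single j 1)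
  have hφL : φ = fun p => c + L p := by
    funext p
    simp [hφ, L, add_assoc]
  have hφc : Continuous φ := hφL ▸ continuous_const.add L.continuous
  have hφd (p : ℝ × ℝ) : HasFDerivAt φ L p := hφL ▸ L.hasFDerivAt.const_add c
  have hfd (p : ℝ × ℝ) : HasFDerivAt (fun p => f (φ p)) ((fderiv ℝ f (φ p)).comp L) p :=
    (hf.differentiable one_ne_zero (φ p)).hasFDerivAt.comp p (hφd p)
  have hgd (p : ℝ × ℝ) : HasFDerivAt (fun p => -g (φ p)) (-(fderiv ℝ g (φ p)).comp L) p :=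
    ((hg.differentiable one_ne_zero (φ p)).hasFDerivAt.comp p (hφd p)).neg
  have hcont : Continuous fun p : ℝ × ℝ => (fderiv ℝ f (φ p)).comp L (1, 0) +
      (-(fderiv ℝ g (φ p)).comp L) (0, 1) :=
    ((((hf.continuous_fderiv one_ne_zero).comp hφc).clm_apply continuous_const).add
      (((hg.continuous_fderiv one_ne_zero).comp hφc).clm_apply continuous_const).neg)
  have key := integral_divergence_prod_Icc_of_hasFDerivAt_of_le (fun p => f (φ p))
    (fun p => -g (φ p)) (fun p => (fderiv ℝ f (φ p)).comp L)
    (fun p => -(fderiv ℝ g (φ p)).comp L) (a₁, a₂) (b₁, b₂) ⟨h₁, h₂⟩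
    (hf.continuous.comp hφc).continuousOn (hg.continuous.comp hφc).neg.continuousOn
    (fun p _ => hfd p) (fun p _ => hgd p) (hcont.continuousOn.integrableOn_compact isCompact_Icc)
  have hL₁ : L (1, 0) = Pi.single i 1 := by simp [L]
  have hL₂ : L (0, 1) = Pi.single j 1 := by simp [L]
  simp only [ContinuousLinearMap.comp_apply, neg_apply, hL₁, hL₂, intervalIntegral.integral_neg,
    ← sub_eq_add_neg, ← Set.Icc_prod_Icc] at key
  simp only [pderiv3, key]
  ring

/-- The total outward flux of the curl of a `C¹` vector field through the
boundary of a rectangular box `[a₁,b₁] × [a₂,b₂] × [a₃,b₃]` vanishes.  Each face integral is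
written as a two-dimensional Lebesgue integral over the corresponding pair of coordinates. -/
theorem flux_of_curl_through_box_boundary_eq_zero
    (K : (Fin 3 → ℝ) → (Fin 3 → ℝ)) (hK : ContDiff ℝ 1 K)
    (a b : Fin 3 → ℝ) (hab : ∀ i, a i ≤ b i) :
    ((∫ p in Set.Icc (a 1) (b 1) ×ˢ Set.Icc (a 2) (b 2),
        curl3 K ![b 0, p.1, p.2] 0) -
      ∫ p in Set.Icc (a 1) (b 1) ×ˢ Set.Icc (a 2) (b 2),
        curl3 K ![a 0, p.1, p.2] 0) +
    ((∫ p in Set.Icc (a 0) (b 0) ×ˢ Set.Icc (a 2) (b 2),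
        curl3 K ![p.1, b 1, p.2] 1) -
      ∫ p in Set.Icc (a 0) (b 0) ×ˢ Set.Icc (a 2) (b 2),
        curl3 K ![p.1, a 1, p.2] 1) +
    ((∫ p in Set.Icc (a 0) (b 0) ×ˢ Set.Icc (a 1) (b 1),
        curl3 K ![p.1, p.2, b 2] 2) -
      ∫ p in Set.Icc (a 0) (b 0) ×ˢ Set.Icc (a 1) (b 1),
        curl3 K ![p.1, p.2, a 2] 2) = 0 := by
  have hc (k : Fin 3) : ContDiff ℝ 1 fun y => K y k := contDiff_pi.1 hK k
  have h0 (s : ℝ) := integral_pderiv3_sub_pderiv3 (hc 2) (hc 1) 1 2 ![s, 0, 0]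
    (fun p => ![s, p.1, p.2])
    (fun p => by ext k; fin_cases k <;> simp [Matrix.vecHead, Matrix.vecTail]) (hab 1) (hab 2)
  have h1 (s : ℝ) := integral_pderiv3_sub_pderiv3 (hc 2) (hc 0) 0 2 ![0, s, 0]
    (fun p => ![p.1, s, p.2])
    (fun p => by ext k; fin_cases k <;> simp [Matrix.vecHead, Matrix.vecTail]) (hab 0) (hab 2)
  have h2 (s : ℝ) := integral_pderiv3_sub_pderiv3 (hc 1) (hc 0) 0 1 ![0, 0, s]
    (fun p => ![p.1, p.2, s])
    (fun p => by ext k; fin_cases k <;> simp [Matrix.vecHead, Matrix.vecTail]) (hab 0) (hab 1)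
  have hcurl0 (x : Fin 3 → ℝ) : curl3 K x 0 =
      pderiv3 1 (fun y => K y 2) x - pderiv3 2 (fun y => K y 1) x := rfl
  have hcurl1 (x : Fin 3 → ℝ) : curl3 K x 1 =
      -(pderiv3 0 (fun y => K y 2) x - pderiv3 2 (fun y => K y 0) x) := (neg_sub _ _).symm
  have hcurl2 (x : Fin 3 → ℝ) : curl3 K x 2 =
      pderiv3 0 (fun y => K y 1) x - pderiv3 1 (fun y => K y 0) x := rfl
  simp only [hcurl0, hcurl1, hcurl2, integral_neg, h0, h1, h2]
  ring
end
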